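/- Let M be a finite simple matroid on a ground set S of rank r ≥ 2, and let 𝓗 be the set of hyperplanes of M. Then M is a paving matroid if and only if for all X, Y ∈ 𝓗 with X ≠ Y, |X| ≥ r and |Y| ≥ r, one has |X ∩ Y| ≤ r − 2. -/

import Mathlib

open Set

namespace Matroid

variable {α : Type*}

/-- A circuit of a matroid: a minimal dependent set. -/
def Circuit' (M : Matroid α) (C : Set α) : Prop :=
  M.Dep C ∧ ∀ D, D ⊂ C → M.Indep D

/-- The rank of a subset `X`: the maximum cardinality of an independent subset of `X`. -/
noncomputable def rk' (M : Matroid α) (X : Set α) : ℕ :=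
  sSup {n | ∃ I, I ⊆ X ∧ M.Indep I ∧ I.ncard = n}

/-- A hyperplane of a matroid of rank `r`: a maximal subset of the ground set of rank `r - 1`. -/
def Hyperplane' (M : Matroid α) (H : Set α) : Prop :=
  H ⊆ M.E ∧ M.rk' H = M.rk' M.E - 1 ∧
    ∀ Y, H ⊂ Y → Y ⊆ M.E → M.rk' Y ≠ M.rk' M.E - 1

/-- A matroid is paving if it has no circuits of cardinality less than its rank. -/
def Paving (M : Matroid α) : Prop :=
  ∀ C, M.Circuit' C → M.rk' M.E ≤ C.ncard

/-- A matroid is sparse-paving if both it and its dual are paving. -/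
def SparsePaving (M : Matroid α) : Prop :=
  M.Paving ∧ M✶.Paving

end Matroid

namespace Matroid

lemma aux_rk_basis {α : Type*} (M : Matroid α) [M.Finite] {I X : Set α} (h : M.IsBasis I X) :
    M.rk' X = I.ncard := by
  have key : ∀ J, J ⊆ X → M.Indep J → J.ncard ≤ I.ncard := by
    intro J hJX hJ
    obtain ⟨K, hK, hJK⟩ := hJ.subset_isBasis_of_subset hJX h.subset_ground
    have h1 : K.encard = I.encard := hK.encard_eq_encard h
    have h2 : K.ncard = I.ncard := by simp [Set.ncard, h1]
    rw [← h2]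
    exact Set.ncard_le_ncard hJK hK.indep.finite
  unfold rk'
  apply le_antisymm
  · refine csSup_le ⟨I.ncard, I, h.subset, h.indep, rfl⟩ ?_
    rintro n ⟨J, hJX, hJ, rfl⟩
    exact key J hJX hJ
  · apply le_csSup
    · refine ⟨I.ncard, ?_⟩
      rintro n ⟨J, hJX, hJ, rfl⟩
      exact key J hJX hJ
    · exact ⟨I, h.subset, h.indep, rfl⟩

lemma aux_le_rk {α : Type*} (M : Matroid α) [M.Finite] {I X : Set α} (hX : X ⊆ M.E)
    (hI : M.Indep I) (hIX : I ⊆ X) : I.ncard ≤ M.rk' X := by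
  obtain ⟨K, hK, hJK⟩ := hI.subset_isBasis_of_subset hIX hX
  rw [M.aux_rk_basis hK]
  exact Set.ncard_le_ncard hJK hK.indep.finite

lemma aux_rk_closure {α : Type*} (M : Matroid α) [M.Finite] {I : Set α}
    (hI : M.Indep I) : M.rk' (M.closure I) = I.ncard :=
  M.aux_rk_basis hI.isBasis_closure

lemma aux_hyp {α : Type*} (M : Matroid α) [M.Finite] {I : Set α}
    (hI : M.Indep I) (hc : I.ncard + 1 = M.rk' M.E) : M.Hyperplane' (M.closure I) := by
  refine ⟨M.closure_subset_ground I, by rw [M.aux_rk_closure hI]; omega, ?_⟩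
  intro Y hY hYE heq
  obtain ⟨y, hy, hyn⟩ := Set.exists_of_ssubset hY
  have hyI : y ∉ I := fun h => hyn (M.subset_closure I hI.subset_ground h)
  have hi : M.Indep (insert y I) := by
    rw [hI.insert_indep_iff_of_notMem hyI]
    exact ⟨hYE hy, hyn⟩
  have := M.aux_le_rk hYE hi
    (Set.insert_subset hy ((M.subset_closure I hI.subset_ground).trans hY.subset))
  rw [Set.ncard_insert_of_notMem hyI hI.finite] at this
  omega

lemma aux_hyp_eq {α : Type*} (M : Matroid α) [M.Finite] {I X : Set α}
    (hI : M.Indep I) (hc : I.ncard = M.rk' M.E - 1) (hX : M.Hyperplane' X) (hIX : I ⊆ X) :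
    X = M.closure I := by
  obtain ⟨hXE, hr, hmax⟩ := hX
  obtain ⟨K, hK, hIK⟩ := hI.subset_isBasis_of_subset hIX hXE
  have h1 := M.aux_rk_basis hK
  have h2 : I = K := Set.eq_of_subset_of_ncard_le hIK (by omega) hK.indep.finite
  subst h2
  by_contra hne
  refine hmax (M.closure I) (hK.subset_closure.ssubset_of_ne hne) (M.closure_subset_ground I) ?_
  rw [M.aux_rk_closure hI, hc]

end Matroid

theorem stmt0 {α : Type*} (M : Matroid α) [M.Finite] (r : ℕ)
    (hr : 2 ≤ r) (hrank : M.rk' M.E = r)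
    (hsimple : ∀ C, M.Circuit' C → C.ncard ≠ 1 ∧ C.ncard ≠ 2) :
    M.Paving ↔ ∀ X Y, M.Hyperplane' X → M.Hyperplane' Y → X ≠ Y →
      r ≤ X.ncard → r ≤ Y.ncard → (X ∩ Y).ncard ≤ r - 2 := by
  constructor
  · intro hP X Y hX hY hne _ _
    by_contra hcon
    obtain ⟨I, hIs, hIc⟩ := Set.exists_subset_card_eq (s := X ∩ Y) (n := r - 1) (by omega)
    have hIE : I ⊆ M.E := fun x hx => hX.1 (hIs hx).1
    have hI : M.Indep I := by
      by_contra hd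
      rw [Matroid.not_indep_iff hIE] at hd
      obtain ⟨C, hCI, hC⟩ := hd.exists_isCircuit_subset
      have h1 := hP C ⟨hC.dep, fun D hD => hC.ssubset_indep hD⟩
      have h2 := Set.ncard_le_ncard hCI (M.ground_finite.subset hIE)
      omega
    apply hne
    rw [M.aux_hyp_eq hI (by omega) hX (fun x hx => (hIs hx).1),
      M.aux_hyp_eq hI (by omega) hY (fun x hx => (hIs hx).2)]
  · intro h C hC
    by_contra hlt
    obtain ⟨e, he⟩ := hC.1.nonempty
    have hCfin : C.Finite := M.ground_finite.subset hC.1.subset_ground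
    have hJ : M.Indep (C \ {e}) := hC.2 _ (Set.diff_singleton_ssubset.2 he)
    have hJc := Set.ncard_diff_singleton_add_one he hCfin
    obtain ⟨B, hB, hJB⟩ := hJ.exists_isBase_superset
    have hBc : B.ncard = r := by rw [← hrank, M.aux_rk_basis hB.isBasis_ground]
    obtain ⟨I, hJI, hIB, hIc⟩ := Set.exists_subsuperset_card_eq (n := r - 2) hJB
      (by omega) (by omega)
    have hI : M.Indep I := hB.indep.subset hIB
    have heC : e ∈ M.closure (C \ {e}) := by
      rw [hJ.mem_closure_iff]
      left
      rw [Set.insert_diff_singleton, Set.insert_eq_of_mem he]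
      exact hC.1
    have heI : e ∈ M.closure I := M.closure_subset_closure hJI heC
    have heB : e ∉ B := by
      intro heB
      apply hC.1.not_indep
      refine hB.indep.subset fun x hx => ?_
      by_cases hxe : x = e
      · rwa [hxe]
      · exact hJB ⟨hx, hxe⟩
    have hdc : (B \ I).ncard = 2 := by
      have := Set.ncard_diff_add_ncard_of_subset hIB hB.finite
      omega
    obtain ⟨a, b, hab, hd⟩ := Set.ncard_eq_two.1 hdc
    have ha : a ∈ B \ I := by rw [hd]; simp
    have hb : b ∈ B \ I := by rw [hd]; simp
    have main : ∀ x ∈ B \ I, M.Indep (insert x I) ∧ (insert x I).ncard + 1 = r ∧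
        r ≤ (M.closure (insert x I)).ncard := by
      intro x hx
      have hi : M.Indep (insert x I) := hB.indep.subset (Set.insert_subset hx.1 hIB)
      have hc : (insert x I).ncard + 1 = r := by
        rw [Set.ncard_insert_of_notMem hx.2 hI.finite]; omega
      refine ⟨hi, hc, ?_⟩
      have hne : e ∉ insert x I := fun h => heB (Set.insert_subset hx.1 hIB h)
      rw [← hc, ← Set.ncard_insert_of_notMem hne hi.finite]
      refine Set.ncard_le_ncard (Set.insert_subset
        (M.closure_subset_closure (Set.subset_insert _ _) heI)
        (M.subset_closure _ hi.subset_ground))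
        (M.ground_finite.subset (M.closure_subset_ground _))
    obtain ⟨ia, ca, la⟩ := main a ha
    obtain ⟨ib, cb, lb⟩ := main b hb
    have := h _ _ (M.aux_hyp ia (by omega)) (M.aux_hyp ib (by omega)) (by
      intro heq
      have hain : a ∈ M.closure (insert b I) := by
        rw [← heq]; exact M.subset_closure _ ia.subset_ground (Set.mem_insert _ _)
      have hn : a ∉ insert b I := by
        rintro (h1 | h1)
        · exact hab h1
        · exact ha.2 h1
      have hi2 : M.Indep (insert a (insert b I)) :=
        hB.indep.subset (Set.insert_subset ha.1 (Set.insert_subset hb.1 hIB))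
      rw [ib.insert_indep_iff_of_notMem hn] at hi2
      exact hi2.2 hain) la lb
    have h3 : (insert e I).ncard ≤
        (M.closure (insert a I) ∩ M.closure (insert b I)).ncard := by
      refine Set.ncard_le_ncard ?_ (M.ground_finite.subset
        (Set.inter_subset_left.trans (M.closure_subset_ground _)))
      have h4 : insert e I ⊆ M.closure I :=
        Set.insert_subset heI (M.subset_closure _ hI.subset_ground)
      exact Set.subset_inter (h4.trans (M.closure_subset_closure (Set.subset_insert _ _)))
        (h4.trans (M.closure_subset_closure (Set.subset_insert _ _)))
    rw [Set.ncard_insert_of_notMem (fun h => heB (hIB h)) hI.finite] at h3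
    omega
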